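/- arXiv:2211.00950 — 2 statements merged into one kernel-verified Lean document; each statement's English description precedes it below -/
import Mathlib

section
/- Let k ∈ {1,…,7} and let λ = Σ_{i=1}^{7} a_i ϖ_i where the a_i are nonnegative integers and a_k = 0. Then T_{λ,k} ∩ ℤ = {1, 2, …, M_{λ,k}} if and only if for every integer t at least one of the following holds: (1) (λ+ρ−tϖ_k, α) > 0 for every α ∈ Φ⁺; (2) the number of α ∈ Φ⁺ with (λ+ρ−tϖ_k, α) < 0 equals the cardinality of Φ⁺_k and (λ+ρ−tϖ_k, α) ≠ 0 for every α ∈ Φ⁺; (3) there exists α ∈ Φ⁺ with (λ+ρ−tϖ_k, α) = 0. -/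
noncomputable section

/-- The ambient space ℝ^8. -/
abbrev V : Type := Fin 8 → ℝ

/-- The standard inner product on ℝ^8. -/
def ip (x y : V) : ℝ := ∑ i, x i * y i

/-- The standard basis vectors ε_1, …, ε_8 (indexed from 0). -/
def eps (i : Fin 8) : V := fun j => if j = i then 1 else 0

/-- The E8 root system: ±ε_i±ε_j (i<j) together with
    ½∑(−1)^{k(i)}ε_i where the number of minus signs is even. -/
def PhiE8 : Set V :=
  {α | (∃ i j : Fin 8, i < j ∧ ∃ s t : ℝ, (s = 1 ∨ s = -1) ∧ (t = 1 ∨ t = -1) ∧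
          α = s • eps i + t • eps j) ∨
       (∃ k : Fin 8 → Bool,
          Even ((Finset.univ.filter (fun i => k i = true)).card) ∧
          α = ∑ i, (if k i then (-(1 : ℝ)/2) else ((1 : ℝ)/2)) • eps i)}

/-- Simple roots α_1, …, α_8 of E8 (indexed from 0). -/
def sroot : Fin 8 → V :=
  ![(1/2 : ℝ) • (eps 0 - eps 1 - eps 2 - eps 3 - eps 4 - eps 5 - eps 6 + eps 7),
    eps 0 + eps 1,
    eps 1 - eps 0,
    eps 2 - eps 1,
    eps 3 - eps 2,
    eps 4 - eps 3,
    eps 5 - eps 4,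
    eps 6 - eps 5]

/-- The simple roots α_1, …, α_7 of E7. -/
def sroot7 : Fin 7 → V := fun i => sroot (Fin.castLE (by norm_num) i)

/-- The E7 root system: Φ_{E8} ∩ span_ℝ{α_1,…,α_7}. -/
def PhiE7 : Set V :=
  {α | α ∈ PhiE8 ∧ α ∈ Submodule.span ℝ (Set.range sroot7)}

/-- Positive roots of E7: elements of Φ_{E7} that are nonnegative
    combinations of the simple roots. -/
def Pos7 : Set V :=
  {α | α ∈ PhiE7 ∧ ∃ c : Fin 7 → ℝ, (∀ i, 0 ≤ c i) ∧ α = ∑ i, c i • sroot7 i}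

/-- Fundamental weights ϖ_1, …, ϖ_7 of E7 (indexed from 0). -/
def w7 : Fin 7 → V :=
  ![-eps 6 + eps 7,
    (1/2 : ℝ) • (eps 0 + eps 1 + eps 2 + eps 3 + eps 4 + eps 5) - eps 6 + eps 7,
    (1/2 : ℝ) • (-eps 0 + eps 1 + eps 2 + eps 3 + eps 4 + eps 5
      - (3 : ℝ) • eps 6 + (3 : ℝ) • eps 7),
    eps 2 + eps 3 + eps 4 + eps 5 - (2 : ℝ) • eps 6 + (2 : ℝ) • eps 7,
    eps 3 + eps 4 + eps 5 - (3/2 : ℝ) • (eps 6 - eps 7),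
    eps 4 + eps 5 - eps 6 + eps 7,
    eps 5 - (1/2 : ℝ) • (eps 6 - eps 7)]

/-- ρ = ϖ_1 + ⋯ + ϖ_7. -/
def rho7 : V := ∑ i, w7 i

/-- Φ⁺_k = {α ∈ Φ⁺ : (ϖ_k, α) ≠ 0}. -/
def PhiK7 (k : Fin 7) : Set V := {α ∈ Pos7 | ip (w7 k) α ≠ 0}

/-- λ = ∑ a_i ϖ_i. -/
def lam7 (a : Fin 7 → ℕ) : V := ∑ i, (a i : ℝ) • w7 i

/-- T_{λ,k} = {(λ+ρ, α)/c_{α,k} : α ∈ Φ⁺_k}. -/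
def T7 (a : Fin 7 → ℕ) (k : Fin 7) : Set ℝ :=
  {r | ∃ α ∈ PhiK7 k, r = ip (lam7 a + rho7) α / ip (w7 k) α}

/-- M_{λ,k} = max T_{λ,k} (the set is finite and nonempty, so max = sSup). -/
def M7 (a : Fin 7 → ℕ) (k : Fin 7) : ℝ := sSup (T7 a k)

/-- The condition T_{λ,k} ∩ ℤ = {1, 2, …, M_{λ,k}}. -/
def ACM7 (a : Fin 7 → ℕ) (k : Fin 7) : Prop :=
  {n : ℤ | (n : ℝ) ∈ T7 a k} = {n : ℤ | 1 ≤ n ∧ (n : ℝ) ≤ M7 a k}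

lemma ip_add_left (x y z : V) : ip (x + y) z = ip x z + ip y z := by
  simp [ip, add_mul, Finset.sum_add_distrib]

lemma ip_sub_left (x y z : V) : ip (x - y) z = ip x z - ip y z := by
  simp [ip, sub_mul, Finset.sum_sub_distrib]

lemma ip_smul_left (r : ℝ) (x z : V) : ip (r • x) z = r * ip x z := by
  simp [ip, Finset.mul_sum, mul_assoc]

lemma ip_smul_right (r : ℝ) (x z : V) : ip x (r • z) = r * ip x z := by
  simp [ip, Finset.mul_sum, mul_left_comm]

lemma ip_sum_left {ι : Type*} (s : Finset ι) (f : ι → V) (z : V) :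
    ip (∑ i ∈ s, f i) z = ∑ i ∈ s, ip (f i) z := by
  simp only [ip, Finset.sum_apply, Finset.sum_mul]
  exact Finset.sum_comm

lemma ip_sum_right {ι : Type*} (s : Finset ι) (x : V) (f : ι → V) :
    ip x (∑ i ∈ s, f i) = ∑ i ∈ s, ip x (f i) := by
  simp only [ip, Finset.sum_apply, Finset.mul_sum]
  exact Finset.sum_comm

/-- The fundamental weights are dual to the simple roots. -/
lemma ip_w7_sroot7 (i j : Fin 7) : ip (w7 i) (sroot7 j) = if i = j then 1 else 0 := by
  fin_cases i <;> fin_cases j <;>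
    simp [ip, w7, sroot7, sroot, eps, Fin.sum_univ_eight, Fin.castLE] <;> norm_num

lemma ip_w7_sum (i : Fin 7) (c : Fin 7 → ℝ) : ip (w7 i) (∑ j, c j • sroot7 j) = c i := by
  simp [ip_sum_right, ip_smul_right, ip_w7_sroot7]

lemma ip_lam7_add_rho7 (a : Fin 7 → ℕ) (α : V) :
    ip (lam7 a + rho7) α = ∑ i, ((a i : ℝ) + 1) * ip (w7 i) α := by
  simp [lam7, rho7, ip_add_left, ip_sum_left, ip_smul_left, add_mul, Finset.sum_add_distrib]

lemma PhiE8_finite : PhiE8.Finite := by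
  refine Set.Finite.union ?_ ?_
  · refine (Set.finite_range fun p : Fin 8 × Fin 8 × Bool × Bool =>
      (if p.2.2.1 then (1 : ℝ) else -1) • eps p.1 +
        (if p.2.2.2 then (1 : ℝ) else -1) • eps p.2.1).subset ?_
    rintro α ⟨i, j, -, s, t, hs, ht, rfl⟩
    refine ⟨(i, j, decide (s = 1), decide (t = 1)), ?_⟩
    rcases hs with rfl | rfl <;> rcases ht with rfl | rfl <;> norm_num
  · refine (Set.finite_range fun k : Fin 8 → Bool =>
      ∑ i, (if k i then (-(1 : ℝ)/2) else ((1 : ℝ)/2)) • eps i).subset ?_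
    rintro α ⟨k, -, rfl⟩
    exact ⟨k, rfl⟩

lemma Pos7_finite : Pos7.Finite := PhiE8_finite.subset fun _ h => h.1.1

lemma ne_zero_of_mem_PhiE8 {α : V} (h : α ∈ PhiE8) : α ≠ 0 := by
  rintro rfl
  rcases h with ⟨i, j, hij, s, t, hs, -, h⟩ | ⟨k, -, h⟩
  · have := congrFun h i
    simp only [eps, Pi.zero_apply, Pi.add_apply, Pi.smul_apply, smul_eq_mul, hij.ne] at this
    rcases hs with rfl | rfl <;> norm_num at this
  · have := congrFun h 0
    simp only [eps, Pi.zero_apply, Finset.sum_apply, Pi.smul_apply, smul_eq_mul, mul_ite,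
      mul_one, mul_zero, Finset.sum_ite_eq, Finset.mem_univ, if_true] at this
    split_ifs at this <;> norm_num at this

lemma sroot7_mem_PhiE8 (i : Fin 7) : sroot7 i ∈ PhiE8 := by
  fin_cases i
  · refine Or.inr ⟨![false, true, true, true, true, true, true, false], by decide, ?_⟩
    ext j
    fin_cases j <;> simp [sroot7, sroot, eps, Fin.sum_univ_eight, Fin.castLE] <;> norm_num
  · exact Or.inl ⟨0, 1, by decide, 1, 1, by simp, by simp, by simp [sroot7, sroot, Fin.castLE]⟩
  · exact Or.inl ⟨0, 1, by decide, -1, 1, by simp, by simp,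
      by simp [sroot7, sroot, Fin.castLE, sub_eq_neg_add]⟩
  · exact Or.inl ⟨1, 2, by decide, -1, 1, by simp, by simp,
      by simp [sroot7, sroot, Fin.castLE, sub_eq_neg_add]⟩
  · exact Or.inl ⟨2, 3, by decide, -1, 1, by simp, by simp,
      by simp [sroot7, sroot, Fin.castLE, sub_eq_neg_add]⟩
  · exact Or.inl ⟨3, 4, by decide, -1, 1, by simp, by simp,
      by simp [sroot7, sroot, Fin.castLE, sub_eq_neg_add]⟩
  · exact Or.inl ⟨4, 5, by decide, -1, 1, by simp, by simp,
      by simp [sroot7, sroot, Fin.castLE, sub_eq_neg_add]⟩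

lemma sroot7_mem_Pos7 (i : Fin 7) : sroot7 i ∈ Pos7 := by
  refine ⟨⟨sroot7_mem_PhiE8 i, Submodule.subset_span ⟨i, rfl⟩⟩, fun j => if j = i then 1 else 0,
    fun j => ?_, by simp⟩
  dsimp only
  split_ifs <;> norm_num

lemma ip_w7_nonneg {α : V} (h : α ∈ Pos7) (i : Fin 7) : 0 ≤ ip (w7 i) α := by
  obtain ⟨-, c, hc, rfl⟩ := h
  rw [ip_w7_sum]
  exact hc i

/-- `λ + ρ` is strictly dominant. -/
lemma ip_lam7_add_rho7_pos (a : Fin 7 → ℕ) {α : V} (h : α ∈ Pos7) :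
    0 < ip (lam7 a + rho7) α := by
  have hw := ip_w7_nonneg h
  rw [ip_lam7_add_rho7]
  refine (Finset.sum_nonneg fun i _ => mul_nonneg (by positivity) (hw i)).lt_of_ne' fun h0 => ?_
  rw [Finset.sum_eq_zero_iff_of_nonneg fun i _ => mul_nonneg (by positivity) (hw i)] at h0
  have hz : ∀ i, ip (w7 i) α = 0 := fun i =>
    (mul_eq_zero.mp (h0 i (Finset.mem_univ i))).resolve_left (by positivity)
  obtain ⟨⟨h8, -⟩, c, -, rfl⟩ := h
  simp only [ip_w7_sum] at hz
  exact ne_zero_of_mem_PhiE8 h8 (by simp [hz])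

lemma ip_w7_pos {k : Fin 7} {α : V} (h : α ∈ PhiK7 k) : 0 < ip (w7 k) α :=
  (ip_w7_nonneg h.1 k).lt_of_ne' h.2

lemma T7_finite (a : Fin 7 → ℕ) (k : Fin 7) : (T7 a k).Finite := by
  refine ((Pos7_finite.subset fun _ h => h.1 : (PhiK7 k).Finite).image
    fun α => ip (lam7 a + rho7) α / ip (w7 k) α).subset ?_
  rintro r ⟨α, hα, rfl⟩
  exact ⟨α, hα, rfl⟩

lemma pos_of_mem_T7 {a : Fin 7 → ℕ} {k : Fin 7} {r : ℝ} (h : r ∈ T7 a k) : 0 < r := by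
  obtain ⟨α, hα, rfl⟩ := h
  exact div_pos (ip_lam7_add_rho7_pos a hα.1) (ip_w7_pos hα)

lemma sroot7_mem_PhiK7 (k : Fin 7) : sroot7 k ∈ PhiK7 k :=
  ⟨sroot7_mem_Pos7 k, by simp [ip_w7_sroot7]⟩

/-- The simple root `α_k` contributes `a_k + 1` to `T_{λ,k}`. -/
lemma add_one_mem_T7 (a : Fin 7 → ℕ) (k : Fin 7) : (a k : ℝ) + 1 ∈ T7 a k :=
  ⟨sroot7 k, sroot7_mem_PhiK7 k, by simp [ip_lam7_add_rho7, ip_w7_sroot7]⟩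

lemma M7_mem_T7 (a : Fin 7 → ℕ) (k : Fin 7) : M7 a k ∈ T7 a k :=
  Set.Nonempty.csSup_mem ⟨_, add_one_mem_T7 a k⟩ (T7_finite a k)

lemma le_M7 {a : Fin 7 → ℕ} {k : Fin 7} {r : ℝ} (h : r ∈ T7 a k) : r ≤ M7 a k :=
  le_csSup (T7_finite a k).bddAbove h

lemma ip_twist (a : Fin 7 → ℕ) (k : Fin 7) (t : ℝ) (α : V) :
    ip (lam7 a + rho7 - t • w7 k) α = ip (lam7 a + rho7) α - t * ip (w7 k) α := by
  rw [ip_sub_left, ip_smul_left]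

lemma mem_PhiK7_of_ip_twist_nonpos {a : Fin 7 → ℕ} {k : Fin 7} {t : ℝ} {α : V} (h : α ∈ Pos7)
    (ht : ip (lam7 a + rho7 - t • w7 k) α ≤ 0) : α ∈ PhiK7 k := by
  refine ⟨h, fun h0 => ?_⟩
  rw [ip_twist, h0, mul_zero, sub_zero] at ht
  exact (ip_lam7_add_rho7_pos a h).not_ge ht

/-- All pairings with `λ + ρ − tϖ_k` are positive exactly when `t` lies below `T_{λ,k}`. -/
lemma forall_ip_twist_pos_iff (a : Fin 7 → ℕ) (k : Fin 7) (t : ℝ) :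
    (∀ α ∈ Pos7, 0 < ip (lam7 a + rho7 - t • w7 k) α) ↔ ∀ r ∈ T7 a k, t < r := by
  constructor
  · rintro h r ⟨α, hα, rfl⟩
    have := h α hα.1
    rw [ip_twist, sub_pos] at this
    rwa [lt_div_iff₀ (ip_w7_pos hα)]
  · intro h α hα
    by_contra! hn
    have hK := mem_PhiK7_of_ip_twist_nonpos hα hn
    have := h _ ⟨α, hK, rfl⟩
    rw [lt_div_iff₀ (ip_w7_pos hK)] at this
    rw [ip_twist] at hn
    linarith

/-- Some pairing with `λ + ρ − tϖ_k` vanishes exactly when `t ∈ T_{λ,k}`. -/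
lemma exists_ip_twist_eq_zero_iff (a : Fin 7 → ℕ) (k : Fin 7) (t : ℝ) :
    (∃ α ∈ Pos7, ip (lam7 a + rho7 - t • w7 k) α = 0) ↔ t ∈ T7 a k := by
  constructor
  · rintro ⟨α, hα, h⟩
    have hK := mem_PhiK7_of_ip_twist_nonpos hα h.le
    refine ⟨α, hK, ?_⟩
    rw [ip_twist, sub_eq_zero] at h
    rw [h, mul_div_cancel_right₀ _ hK.2]
  · rintro ⟨α, hα, rfl⟩
    exact ⟨α, hα.1, by rw [ip_twist, div_mul_cancel₀ _ hα.2, sub_self]⟩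

/-- The number of negative pairings with `λ + ρ − tϖ_k` is `|Φ⁺_k|` exactly when `t` lies
above `T_{λ,k}`. -/
lemma ncard_ip_twist_neg_eq_iff (a : Fin 7 → ℕ) (k : Fin 7) (t : ℝ) :
    {α ∈ Pos7 | ip (lam7 a + rho7 - t • w7 k) α < 0}.ncard = (PhiK7 k).ncard ↔ M7 a k < t := by
  have hsub : {α ∈ Pos7 | ip (lam7 a + rho7 - t • w7 k) α < 0} ⊆ PhiK7 k :=
    fun α hα => mem_PhiK7_of_ip_twist_nonpos hα.1 hα.2.le
  constructor
  · intro h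
    have heq := Set.eq_of_subset_of_ncard_le hsub h.ge (Pos7_finite.subset fun _ h => h.1)
    obtain ⟨α, hα, hM⟩ := M7_mem_T7 a k
    have hneg := (heq.symm ▸ hα : α ∈ {α ∈ Pos7 | ip (lam7 a + rho7 - t • w7 k) α < 0}).2
    rw [ip_twist, sub_neg] at hneg
    rwa [hM, div_lt_iff₀ (ip_w7_pos hα)]
  · intro h
    congr 1
    refine hsub.antisymm fun α hα => ⟨hα.1, ?_⟩
    have := (le_M7 ⟨α, hα, rfl⟩).trans_lt h
    rwa [div_lt_iff₀ (ip_w7_pos hα), ← sub_neg, ← ip_twist] at this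

/-- the Borel–Weil–Bott criterion for `T_{λ,k} ∩ ℤ = [1, M_{λ,k}]`
    on E7/P_{α_k}. -/
theorem stmt1 (k : Fin 7) (a : Fin 7 → ℕ) (hk : a k = 0) :
    ACM7 a k ↔
      ∀ t : ℤ,
        (∀ α ∈ Pos7, 0 < ip (lam7 a + rho7 - (t : ℝ) • w7 k) α) ∨
        ({α ∈ Pos7 | ip (lam7 a + rho7 - (t : ℝ) • w7 k) α < 0}.ncard
            = (PhiK7 k).ncard ∧
          ∀ α ∈ Pos7, ip (lam7 a + rho7 - (t : ℝ) • w7 k) α ≠ 0) ∨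
        (∃ α ∈ Pos7, ip (lam7 a + rho7 - (t : ℝ) • w7 k) α = 0) := by
  have hone : (1 : ℝ) ∈ T7 a k := by simpa [hk] using add_one_mem_T7 a k
  simp only [forall_ip_twist_pos_iff, ncard_ip_twist_neg_eq_iff, exists_ip_twist_eq_zero_iff]
  constructor
  · intro h t
    by_cases ht : (t : ℝ) ∈ T7 a k
    · exact Or.inr (Or.inr ht)
    have hnot : ¬(1 ≤ t ∧ (t : ℝ) ≤ M7 a k) := fun hmem => ht (h.symm.subset hmem)
    rcases lt_or_ge t 1 with h1 | h1
    · have h0 : (t : ℝ) ≤ 0 := by exact_mod_cast Int.lt_add_one_iff.mp h1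
      exact Or.inl fun r hr => h0.trans_lt (pos_of_mem_T7 hr)
    · refine Or.inr (Or.inl ⟨not_le.mp fun hle => hnot ⟨h1, hle⟩, fun α hα h0 => ht ?_⟩)
      exact (exists_ip_twist_eq_zero_iff a k t).mp ⟨α, hα, h0⟩
  · intro h
    ext n
    constructor
    · intro hn
      have hpos : (0 : ℝ) < n := pos_of_mem_T7 hn
      exact ⟨by exact_mod_cast hpos, le_M7 hn⟩
    · rintro ⟨h1, hM⟩
      rcases h n with hlt | ⟨hgt, -⟩ | hmem
      · have : (n : ℝ) < 1 := hlt 1 hone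
        exact absurd h1 (not_le.mpr (by exact_mod_cast this))
      · exact absurd hM (not_le.mpr hgt)
      · exact hmem
end
end

section
/- Let λ = Σ_{i=1}^{8} a_i ϖ_i with all a_i nonnegative integers and a_8 = 0. Then T_{λ,8} ∩ ℤ = {1, 2, …, M_{λ,8}} if and only if (a_1,…,a_8) equals (i,0,0,0,0,0,0,0) with 0 ≤ i ≤ 5, or (i,0,1,0,0,0,0,0) with 0 ≤ i ≤ 5, or (j,1,0,0,0,0,0,0) with 1 ≤ j ≤ 4, or (0,k,0,0,0,0,0,0) with 1 ≤ k ≤ 2. (This is the combinatorial criterion, via the main theorem, for an initialized irreducible homogeneous vector bundle on E8/P_{α_8} with highest weight λ to be an ACM bundle.) -/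
noncomputable section

/-- Positive roots of E8: elements of Φ_{E8} that are nonnegative
    combinations of the simple roots. -/
def Pos8 : Set V :=
  {α | α ∈ PhiE8 ∧ ∃ c : Fin 8 → ℝ, (∀ i, 0 ≤ c i) ∧ α = ∑ i, c i • sroot i}

/-- Fundamental weights ϖ_1, …, ϖ_8 of E8 (indexed from 0). -/
def w8 : Fin 8 → V :=
  ![(2 : ℝ) • eps 7,
    (1/2 : ℝ) • (eps 0 + eps 1 + eps 2 + eps 3 + eps 4 + eps 5 + eps 6
      + (5 : ℝ) • eps 7),
    (1/2 : ℝ) • (-eps 0 + eps 1 + eps 2 + eps 3 + eps 4 + eps 5 + eps 6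
      + (7 : ℝ) • eps 7),
    eps 2 + eps 3 + eps 4 + eps 5 + eps 6 + (5 : ℝ) • eps 7,
    eps 3 + eps 4 + eps 5 + eps 6 + (4 : ℝ) • eps 7,
    eps 4 + eps 5 + eps 6 + (3 : ℝ) • eps 7,
    eps 5 + eps 6 + (2 : ℝ) • eps 7,
    eps 6 + eps 7]

/-- ρ = ϖ_1 + ⋯ + ϖ_8. -/
def rho8 : V := ∑ i, w8 i

/-- Φ⁺_k = {α ∈ Φ⁺ : (ϖ_k, α) ≠ 0}. -/
def PhiK8 (k : Fin 8) : Set V := {α ∈ Pos8 | ip (w8 k) α ≠ 0}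

/-- λ = ∑ a_i ϖ_i. -/
def lam8 (a : Fin 8 → ℕ) : V := ∑ i, (a i : ℝ) • w8 i

/-- T_{λ,k} = {(λ+ρ, α)/c_{α,k} : α ∈ Φ⁺_k}. -/
def T8 (a : Fin 8 → ℕ) (k : Fin 8) : Set ℝ :=
  {r | ∃ α ∈ PhiK8 k, r = ip (lam8 a + rho8) α / ip (w8 k) α}

/-- M_{λ,k} = max T_{λ,k} (the set is finite and nonempty, so max = sSup). -/
def M8 (a : Fin 8 → ℕ) (k : Fin 8) : ℝ := sSup (T8 a k)

/-- The condition T_{λ,k} ∩ ℤ = {1, 2, …, M_{λ,k}}. -/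
def ACM8 (a : Fin 8 → ℕ) (k : Fin 8) : Prop :=
  {n : ℤ | (n : ℝ) ∈ T8 a k} = {n : ℤ | 1 ≤ n ∧ (n : ℝ) ≤ M8 a k}

/-- Coordinates, in the basis of simple roots, of the positive roots with nonzero
`α_8`-coefficient. -/
def coeffs : List (Fin 8 → ℕ) :=
  [![0, 0, 0, 0, 0, 0, 0, 1],
    ![0, 0, 0, 0, 0, 0, 1, 1],
    ![0, 0, 0, 0, 0, 1, 1, 1],
    ![0, 0, 0, 0, 1, 1, 1, 1],
    ![0, 0, 0, 1, 1, 1, 1, 1],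
    ![0, 1, 0, 1, 1, 1, 1, 1],
    ![0, 0, 1, 1, 1, 1, 1, 1],
    ![0, 1, 1, 1, 1, 1, 1, 1],
    ![1, 0, 1, 1, 1, 1, 1, 1],
    ![0, 1, 1, 2, 1, 1, 1, 1],
    ![1, 1, 1, 1, 1, 1, 1, 1],
    ![0, 1, 1, 2, 2, 1, 1, 1],
    ![1, 1, 1, 2, 1, 1, 1, 1],
    ![0, 1, 1, 2, 2, 2, 1, 1],
    ![1, 1, 1, 2, 2, 1, 1, 1],
    ![1, 1, 2, 2, 1, 1, 1, 1],
    ![0, 1, 1, 2, 2, 2, 2, 1],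
    ![1, 1, 1, 2, 2, 2, 1, 1],
    ![1, 1, 2, 2, 2, 1, 1, 1],
    ![1, 1, 1, 2, 2, 2, 2, 1],
    ![1, 1, 2, 2, 2, 2, 1, 1],
    ![1, 1, 2, 3, 2, 1, 1, 1],
    ![1, 2, 2, 3, 2, 1, 1, 1],
    ![1, 1, 2, 2, 2, 2, 2, 1],
    ![1, 1, 2, 3, 2, 2, 1, 1],
    ![1, 2, 2, 3, 2, 2, 1, 1],
    ![1, 1, 2, 3, 2, 2, 2, 1],
    ![1, 1, 2, 3, 3, 2, 1, 1],
    ![1, 2, 2, 3, 2, 2, 2, 1],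
    ![1, 2, 2, 3, 3, 2, 1, 1],
    ![1, 1, 2, 3, 3, 2, 2, 1],
    ![1, 2, 2, 3, 3, 2, 2, 1],
    ![1, 2, 2, 4, 3, 2, 1, 1],
    ![1, 1, 2, 3, 3, 3, 2, 1],
    ![1, 2, 2, 3, 3, 3, 2, 1],
    ![1, 2, 2, 4, 3, 2, 2, 1],
    ![1, 2, 3, 4, 3, 2, 1, 1],
    ![2, 2, 3, 4, 3, 2, 1, 1],
    ![1, 2, 2, 4, 3, 3, 2, 1],
    ![1, 2, 3, 4, 3, 2, 2, 1],
    ![2, 2, 3, 4, 3, 2, 2, 1],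
    ![1, 2, 2, 4, 4, 3, 2, 1],
    ![1, 2, 3, 4, 3, 3, 2, 1],
    ![2, 2, 3, 4, 3, 3, 2, 1],
    ![1, 2, 3, 4, 4, 3, 2, 1],
    ![2, 2, 3, 4, 4, 3, 2, 1],
    ![1, 2, 3, 5, 4, 3, 2, 1],
    ![2, 2, 3, 5, 4, 3, 2, 1],
    ![1, 3, 3, 5, 4, 3, 2, 1],
    ![2, 3, 3, 5, 4, 3, 2, 1],
    ![2, 2, 4, 5, 4, 3, 2, 1],
    ![2, 3, 4, 5, 4, 3, 2, 1],
    ![2, 3, 4, 6, 4, 3, 2, 1],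
    ![2, 3, 4, 6, 5, 3, 2, 1],
    ![2, 3, 4, 6, 5, 4, 2, 1],
    ![2, 3, 4, 6, 5, 4, 3, 1],
    ![2, 3, 4, 6, 5, 4, 3, 2]
]

/-- Twice the coordinates of the simple roots. -/
def srootInt : Fin 8 → Fin 8 → ℤ :=
  ![![1, -1, -1, -1, -1, -1, -1, 1],
    ![2, 2, 0, 0, 0, 0, 0, 0],
    ![-2, 2, 0, 0, 0, 0, 0, 0],
    ![0, -2, 2, 0, 0, 0, 0, 0],
    ![0, 0, -2, 2, 0, 0, 0, 0],
    ![0, 0, 0, -2, 2, 0, 0, 0],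
    ![0, 0, 0, 0, -2, 2, 0, 0],
    ![0, 0, 0, 0, 0, -2, 2, 0]]

/-- Twice the coordinates of the fundamental weights. -/
def weightInt : Fin 8 → Fin 8 → ℤ :=
  ![![0, 0, 0, 0, 0, 0, 0, 4],
    ![1, 1, 1, 1, 1, 1, 1, 5],
    ![-1, 1, 1, 1, 1, 1, 1, 7],
    ![0, 0, 2, 2, 2, 2, 2, 10],
    ![0, 0, 0, 2, 2, 2, 2, 8],
    ![0, 0, 0, 0, 2, 2, 2, 6],
    ![0, 0, 0, 0, 0, 2, 2, 4],
    ![0, 0, 0, 0, 0, 0, 2, 2]]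

/-- The vector `2 (± ε_i ± ε_j)`, where `true` stands for a minus sign. -/
def pairVec (i j : Fin 8) (s t : Bool) : Fin 8 → ℤ := fun l =>
  (if l = i then (if s then -2 else 2) else 0) + (if l = j then (if t then -2 else 2) else 0)

/-- The vector `∑ (-1)^{k(i)} ε_i`. -/
def signVec (k : Fin 8 → Bool) : Fin 8 → ℤ := fun l => if k l then -1 else 1

/-- `x` is twice an E8 root. -/
def IsDoubledRoot (x : Fin 8 → ℤ) : Prop :=
  (∃ i j : Fin 8, i < j ∧ ∃ s t : Bool, x = pairVec i j s t) ∨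
    ∃ k : Fin 8 → Bool, Even ((Finset.univ.filter (fun i => k i = true)).card) ∧ x = signVec k

/-- Four times the simple-root coordinates of the vector `x / 2`. -/
def quadCoeff (x : Fin 8 → ℤ) (i : Fin 8) : ℤ :=
  weightInt i 0 * x 0 + weightInt i 1 * x 1 + weightInt i 2 * x 2 + weightInt i 3 * x 3 +
    weightInt i 4 * x 4 + weightInt i 5 * x 5 + weightInt i 6 * x 6 + weightInt i 7 * x 7

lemma quadCoeff_eq_sum (x : Fin 8 → ℤ) (i : Fin 8) :
    quadCoeff x i = ∑ j, weightInt i j * x j := by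
  rw [Fin.sum_univ_eight, quadCoeff]

lemma sroot_eq (i j : Fin 8) : sroot i j = (srootInt i j : ℝ) / 2 := by
  fin_cases i <;> fin_cases j <;> simp [sroot, srootInt, eps] <;> norm_num

lemma w8_eq (i j : Fin 8) : w8 i j = (weightInt i j : ℝ) / 2 := by
  fin_cases i <;> fin_cases j <;> simp [w8, weightInt, eps] <;> norm_num

lemma mem_PhiE8_iff (α : V) :
    α ∈ PhiE8 ↔ ∃ x, IsDoubledRoot x ∧ α = fun l => (x l : ℝ) / 2 := by
  constructor
  · rintro (⟨i, j, hij, s, t, hs, ht, rfl⟩ | ⟨k, hk, rfl⟩)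
    · refine ⟨pairVec i j (decide (s = -1)) (decide (t = -1)),
        Or.inl ⟨i, j, hij, _, _, rfl⟩, ?_⟩
      have hne : (1 : ℝ) ≠ -1 := by norm_num
      funext l
      rcases hs with rfl | rfl <;> rcases ht with rfl | rfl <;>
        simp [pairVec, eps, hne] <;> split_ifs <;> norm_num
    · refine ⟨signVec k, Or.inr ⟨k, hk, rfl⟩, ?_⟩
      funext l
      simp only [Finset.sum_apply, Pi.smul_apply, eps, smul_eq_mul, mul_ite, mul_one, mul_zero,
        Finset.sum_ite_eq, Finset.mem_univ, if_true, signVec]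
      split_ifs <;> norm_num
  · rintro ⟨x, ⟨i, j, hij, s, t, rfl⟩ | ⟨k, hk, rfl⟩, rfl⟩
    · refine Or.inl ⟨i, j, hij, if s then -1 else 1, if t then -1 else 1, ?_, ?_, ?_⟩
      · cases s <;> simp
      · cases t <;> simp
      · funext l
        cases s <;> cases t <;> simp [pairVec, eps] <;> split_ifs <;> norm_num
    · refine Or.inr ⟨k, hk, ?_⟩
      funext l
      simp only [Finset.sum_apply, Pi.smul_apply, eps, smul_eq_mul, mul_ite, mul_one, mul_zero,
        Finset.sum_ite_eq, Finset.mem_univ, if_true, signVec]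
      split_ifs <;> norm_num

lemma weightInt_dual (i j : Fin 8) :
    ∑ l, weightInt i l * srootInt j l = if i = j then 4 else 0 := by
  revert i j
  decide +kernel

lemma ip_sum_smul (x : V) (c : Fin 8 → ℝ) (y : Fin 8 → V) :
    ip x (∑ j, c j • y j) = ∑ j, c j * ip x (y j) := by
  simp only [ip, Finset.sum_apply, Pi.smul_apply, smul_eq_mul, Finset.mul_sum]
  rw [Finset.sum_comm]
  exact Finset.sum_congr rfl fun _ _ => Finset.sum_congr rfl fun _ _ => by ring

lemma ip_w8_sroot (i j : Fin 8) : ip (w8 i) (sroot j) = if i = j then 1 else 0 := by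
  have h := congrArg (Int.cast : ℤ → ℝ) (weightInt_dual i j)
  push_cast at h
  have h' : ip (w8 i) (sroot j) = (∑ l, (weightInt i l : ℝ) * srootInt j l) / 4 := by
    simp only [ip, w8_eq, sroot_eq, Finset.sum_div]
    exact Finset.sum_congr rfl fun _ _ => by ring
  rw [h', h]
  split_ifs <;> norm_num

lemma ip_w8_combination (i : Fin 8) (c : Fin 8 → ℝ) :
    ip (w8 i) (∑ j, c j • sroot j) = c i := by
  simp [ip_sum_smul, ip_w8_sroot]

lemma ip_add_rho8_combination (a : Fin 8 → ℕ) (c : Fin 8 → ℝ) :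
    ip (lam8 a + rho8) (∑ j, c j • sroot j) = ∑ i, ((a i : ℝ) + 1) * c i := by
  have h (y : V) : ip (lam8 a + rho8) y = ∑ i, ((a i : ℝ) + 1) * ip (w8 i) y := by
    simp only [ip, lam8, rho8, Pi.add_apply, Finset.sum_apply, Pi.smul_apply, smul_eq_mul,
      ← Finset.sum_add_distrib, Finset.mul_sum, Finset.sum_mul]
    rw [Finset.sum_comm]
    exact Finset.sum_congr rfl fun _ _ => Finset.sum_congr rfl fun _ _ => by ring
  simp only [h, ip_w8_combination]

lemma ip_w8_half (x : Fin 8 → ℤ) (i : Fin 8) :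
    ip (w8 i) (fun l => (x l : ℝ) / 2) = (quadCoeff x i : ℝ) / 4 := by
  simp only [ip, w8_eq, quadCoeff_eq_sum, Int.cast_sum, Int.cast_mul, Finset.sum_div]
  exact Finset.sum_congr rfl fun _ _ => by ring

lemma exists_coeffs_of_pairVec : ∀ i j : Fin 8, i < j → ∀ s t : Bool,
    (∀ l, 0 ≤ quadCoeff (pairVec i j s t) l) → quadCoeff (pairVec i j s t) 7 ≠ 0 →
      ∃ c ∈ coeffs, ∀ l, quadCoeff (pairVec i j s t) l = 4 * c l := by
  decide +kernel

lemma exists_coeffs_of_signVec : ∀ k : Fin 8 → Bool,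
    Even ((Finset.univ.filter (fun i => k i = true)).card) →
    (∀ l, 0 ≤ quadCoeff (signVec k) l) → quadCoeff (signVec k) 7 ≠ 0 →
      ∃ c ∈ coeffs, ∀ l, quadCoeff (signVec k) l = 4 * c l := by
  decide +kernel

/-- Twice the vector with simple-root coordinates `c`. -/
def doubledVec (c : Fin 8 → ℕ) (l : Fin 8) : ℤ :=
  c 0 * srootInt 0 l + c 1 * srootInt 1 l + c 2 * srootInt 2 l + c 3 * srootInt 3 l +
    c 4 * srootInt 4 l + c 5 * srootInt 5 l + c 6 * srootInt 6 l + c 7 * srootInt 7 l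

lemma doubledVec_eq_sum (c : Fin 8 → ℕ) (l : Fin 8) :
    doubledVec c l = ∑ i, c i * srootInt i l := by
  rw [Fin.sum_univ_eight, doubledVec]

lemma signVec_or_pairVec_of_mem_coeffs : ∀ c ∈ coeffs,
    ((∀ l, doubledVec c l = signVec (fun i => decide (doubledVec c i = -1)) l) ∧
      Even ((Finset.univ.filter fun i => decide (doubledVec c i = -1) = true).card)) ∨
    ∃ i j : Fin 8, i < j ∧ ∃ s t : Bool, ∀ l, doubledVec c l = pairVec i j s t l := by
  decide +kernel

lemma isDoubledRoot_of_mem_coeffs (c : Fin 8 → ℕ) (hc : c ∈ coeffs) :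
    IsDoubledRoot (doubledVec c) := by
  rcases signVec_or_pairVec_of_mem_coeffs c hc with ⟨h, heven⟩ | ⟨i, j, hij, s, t, h⟩
  · exact Or.inr ⟨_, heven, funext h⟩
  · exact Or.inl ⟨i, j, hij, s, t, funext h⟩

lemma last_pos_of_mem_coeffs : ∀ c ∈ coeffs, 0 < c 7 := by
  decide +kernel

lemma mem_PhiK8_iff (α : V) :
    α ∈ PhiK8 7 ↔ ∃ c ∈ coeffs, α = ∑ i, (c i : ℝ) • sroot i := by
  constructor
  · rintro ⟨⟨hα, d, hd, hsum⟩, h7⟩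
    obtain ⟨x, hx, hxα⟩ := (mem_PhiE8_iff α).1 hα
    have hq (i : Fin 8) : (quadCoeff x i : ℝ) = 4 * d i := by
      have h := ip_w8_half x i
      rw [← hxα, hsum, ip_w8_combination] at h
      linarith
    have hnonneg (i : Fin 8) : 0 ≤ quadCoeff x i := by
      have h : (0 : ℝ) ≤ quadCoeff x i := by rw [hq]; linarith [hd i]
      exact_mod_cast h
    have hne : quadCoeff x 7 ≠ 0 := by
      intro h0
      have h := hq 7
      rw [h0] at h
      rw [hsum, ip_w8_combination] at h7
      apply h7
      push_cast at h
      linarith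
    have hc : ∃ c ∈ coeffs, ∀ l, quadCoeff x l = 4 * c l := by
      rcases hx with ⟨i, j, hij, s, t, rfl⟩ | ⟨k, hk, rfl⟩
      · exact exists_coeffs_of_pairVec i j hij s t hnonneg hne
      · exact exists_coeffs_of_signVec k hk hnonneg hne
    obtain ⟨c, hc, hcq⟩ := hc
    refine ⟨c, hc, hsum.trans (Finset.sum_congr rfl fun i _ => ?_)⟩
    have h := hq i
    rw [hcq] at h
    push_cast at h
    congr 1
    linarith
  · rintro ⟨c, hc, rfl⟩
    refine ⟨⟨(mem_PhiE8_iff _).2 ⟨_, isDoubledRoot_of_mem_coeffs c hc, ?_⟩,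
      fun i => c i, fun i => Nat.cast_nonneg _, rfl⟩, ?_⟩
    · funext l
      simp only [Finset.sum_apply, Pi.smul_apply, smul_eq_mul, sroot_eq, doubledVec_eq_sum,
        Int.cast_sum, Int.cast_mul, Int.cast_natCast, Finset.sum_div]
      exact Finset.sum_congr rfl fun _ _ => by ring
    · rw [ip_w8_combination 7 fun i => (c i : ℝ)]
      exact_mod_cast Nat.ne_of_gt (last_pos_of_mem_coeffs c hc)

/-- The pairing of `λ + ρ` with the root with coordinates `c`. -/
def pairing (a c : Fin 8 → ℕ) : ℕ :=
  (a 0 + 1) * c 0 + (a 1 + 1) * c 1 + (a 2 + 1) * c 2 + (a 3 + 1) * c 3 +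
    (a 4 + 1) * c 4 + (a 5 + 1) * c 5 + (a 6 + 1) * c 6 + (a 7 + 1) * c 7

lemma pairing_eq_sum (a c : Fin 8 → ℕ) : pairing a c = ∑ i, (a i + 1) * c i := by
  rw [Fin.sum_univ_eight, pairing]

lemma mem_T8_iff (a : Fin 8 → ℕ) (r : ℝ) :
    r ∈ T8 a 7 ↔ ∃ c ∈ coeffs, r * c 7 = pairing a c := by
  have key (c : Fin 8 → ℕ) (hc : c ∈ coeffs) :
      r = ip (lam8 a + rho8) (∑ i, (c i : ℝ) • sroot i) /
        ip (w8 7) (∑ i, (c i : ℝ) • sroot i) ↔ r * c 7 = pairing a c := by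
    have h7 : (c 7 : ℝ) ≠ 0 := by exact_mod_cast Nat.ne_of_gt (last_pos_of_mem_coeffs c hc)
    rw [ip_add_rho8_combination a fun i => (c i : ℝ), ip_w8_combination 7 fun i => (c i : ℝ),
      eq_div_iff h7]
    simp [pairing_eq_sum]
  constructor
  · rintro ⟨α, hα, hr⟩
    obtain ⟨c, hc, rfl⟩ := (mem_PhiK8_iff α).1 hα
    exact ⟨c, hc, (key c hc).1 hr⟩
  · rintro ⟨c, hc, hr⟩
    exact ⟨_, (mem_PhiK8_iff _).2 ⟨c, hc, rfl⟩, (key c hc).2 hr⟩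

/-- Coordinates of the root at which the maximum of `T_{λ,8}` is attained. -/
def topCoeff : Fin 8 → ℕ := ![2, 3, 4, 6, 5, 4, 3, 1]

lemma topCoeff_mem : topCoeff ∈ coeffs := by
  decide +kernel

lemma le_topCoeff_mul : ∀ c ∈ coeffs, ∀ i, c i ≤ topCoeff i * c 7 := by
  decide +kernel

lemma pairing_mono (a : Fin 8 → ℕ) {c d : Fin 8 → ℕ} (m n : ℕ) (h : ∀ i, c i * m ≤ d i * n) :
    pairing a c * m ≤ pairing a d * n := by
  simp only [pairing_eq_sum, Finset.sum_mul, mul_assoc]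
  exact Finset.sum_le_sum fun i _ => Nat.mul_le_mul_left _ (h i)

lemma le_pairing_topCoeff (a : Fin 8 → ℕ) {r : ℝ} (hr : r ∈ T8 a 7) :
    r ≤ pairing a topCoeff := by
  obtain ⟨c, hc, h⟩ := (mem_T8_iff a r).1 hr
  have h7 : (0 : ℝ) < c 7 := by exact_mod_cast last_pos_of_mem_coeffs c hc
  have hle := pairing_mono a 1 (c 7) fun i => by simpa using le_topCoeff_mul c hc i
  rw [mul_one] at hle
  refine le_of_mul_le_mul_right ?_ h7
  rw [h]
  exact_mod_cast hle

lemma M8_eq (a : Fin 8 → ℕ) : M8 a 7 = pairing a topCoeff :=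
  IsGreatest.csSup_eq ⟨(mem_T8_iff a _).2 ⟨_, topCoeff_mem, by simp [topCoeff]⟩,
    fun _ hr => le_pairing_topCoeff a hr⟩

/-- Every integer from `1` to the maximum is attained. -/
def Covers (a : Fin 8 → ℕ) : Prop :=
  ∀ n < pairing a topCoeff, ∃ c ∈ coeffs, (n + 1) * c 7 = pairing a c

instance : DecidablePred Covers := fun a => by
  unfold Covers; infer_instance

lemma natCast_mem_T8_iff (a : Fin 8 → ℕ) (n : ℕ) :
    (n : ℝ) ∈ T8 a 7 ↔ ∃ c ∈ coeffs, n * c 7 = pairing a c := by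
  rw [mem_T8_iff]
  exact_mod_cast Iff.rfl

lemma pos_of_mem_T8 (a : Fin 8 → ℕ) {r : ℝ} (hr : r ∈ T8 a 7) : 0 < r := by
  obtain ⟨c, hc, h⟩ := (mem_T8_iff a r).1 hr
  have h7 := last_pos_of_mem_coeffs c hc
  have hp : 0 < pairing a c := by
    unfold pairing
    positivity
  have h7' : (0 : ℝ) < c 7 := by exact_mod_cast h7
  refine pos_of_mul_pos_left ?_ h7'.le
  rw [h]
  exact_mod_cast hp

lemma ACM8_iff_covers (a : Fin 8 → ℕ) : ACM8 a 7 ↔ Covers a := by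
  rw [ACM8, M8_eq, Set.ext_iff]
  constructor
  · intro h n hn
    have h' := (h ((n + 1 : ℕ) : ℤ)).2 ⟨by push_cast; omega, by exact_mod_cast hn⟩
    exact (natCast_mem_T8_iff a (n + 1)).1 (by exact_mod_cast h')
  · intro h n
    constructor
    · intro hn
      have hpos : (0 : ℝ) < n := pos_of_mem_T8 a hn
      exact ⟨by exact_mod_cast hpos, le_pairing_topCoeff a hn⟩
    · rintro ⟨h1, h2⟩
      obtain ⟨m, rfl⟩ : ∃ m : ℕ, n = ((m + 1 : ℕ) : ℤ) := ⟨(n - 1).toNat, by omega⟩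
      have hm : m < pairing a topCoeff := by exact_mod_cast h2
      have := (natCast_mem_T8_iff a (m + 1)).2 (h m hm)
      exact_mod_cast this

lemma pairing_topCoeff_le_of_covers {a : Fin 8 → ℕ} (h : Covers a) :
    pairing a topCoeff ≤ 57 := by
  have hsub : Finset.range (pairing a topCoeff) ⊆
      (coeffs.map fun c => pairing a c / c 7 - 1).toFinset := by
    intro n hn
    obtain ⟨c, hc, hcn⟩ := h n (Finset.mem_range.1 hn)
    refine List.mem_toFinset.2 (List.mem_map.2 ⟨c, hc, ?_⟩)
    rw [← hcn, Nat.mul_div_cancel _ (last_pos_of_mem_coeffs c hc), Nat.add_sub_cancel]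
  calc pairing a topCoeff = (Finset.range (pairing a topCoeff)).card := by simp
    _ ≤ _ := Finset.card_le_card hsub
    _ ≤ _ := List.toFinset_card_le _
    _ = 57 := by simp [coeffs]

/-- Coordinates of the root `α_{8-m} + ⋯ + α_8`. -/
def chain (m : ℕ) : Fin 8 → ℕ := fun i => if 7 ≤ (i : ℕ) + m then 1 else 0

/-- Coordinates of `α_2 + α_4 + ⋯ + α_8`. -/
def chainTwo : Fin 8 → ℕ := ![0, 1, 0, 1, 1, 1, 1, 1]

lemma chain_or_le : ∀ c ∈ coeffs, ∀ m < 5,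
    (∃ j < m, c = chain j) ∨ ∀ i, chain m i * c 7 ≤ c i * 1 := by
  decide +kernel

lemma chain_or_branch : ∀ c ∈ coeffs,
    (∃ j < 5, c = chain j) ∨ (∀ i, chain 5 i * c 7 ≤ c i * 1) ∨
      ∀ i, chainTwo i * c 7 ≤ c i * 1 := by
  decide +kernel

lemma pairing_chain {a : Fin 8 → ℕ} {j m : ℕ} (hj : j < m) (hm : m ≤ 7)
    (h : ∀ i : Fin 8, 8 ≤ (i : ℕ) + m → a i = 0) : pairing a (chain j) = j + 1 := by
  have : pairing a (chain j) = pairing 0 (chain j) := by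
    simp only [pairing_eq_sum]
    refine Finset.sum_congr rfl fun i _ => ?_
    by_cases hi : 7 ≤ (i : ℕ) + j
    · rw [h i (by omega)]; rfl
    · simp [chain, hi]
  rw [this]
  have hj7 : j < 7 := by omega
  clear * - hj7
  interval_cases j <;> decide

lemma pairing_le_of_mul_le {a c d : Fin 8 → ℕ} {n : ℕ} (hc : c ∈ coeffs)
    (hcn : n * c 7 = pairing a c) (h : ∀ i, d i * c 7 ≤ c i * 1) : pairing a d ≤ n := by
  have hle := pairing_mono a (c 7) 1 h
  rw [mul_one, ← hcn] at hle
  exact Nat.le_of_mul_le_mul_right hle (last_pos_of_mem_coeffs c hc)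

lemma twentyEight_le_pairing_topCoeff (a : Fin 8 → ℕ) : 28 ≤ pairing a topCoeff := by
  simp [pairing, topCoeff]
  omega

lemma eq_zero_of_covers {a : Fin 8 → ℕ} (h7 : a 7 = 0) (h : Covers a) :
    ∀ m ≤ 5, ∀ i : Fin 8, 8 ≤ (i : ℕ) + m → a i = 0 := by
  intro m
  induction m with
  | zero => intro _ i hi; omega
  | succ m ih =>
    intro hm i hi
    have ih := ih (by omega)
    by_cases hi' : 8 ≤ (i : ℕ) + m
    · exact ih i hi'
    rcases Nat.eq_zero_or_pos m with rfl | hm0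
    · rwa [show i = 7 from Fin.ext (by simp; omega)]
    have hM := twentyEight_le_pairing_topCoeff a
    obtain ⟨c, hc, hcn⟩ := h m (by omega)
    rcases chain_or_le c hc m (by omega) with ⟨j, hj, rfl⟩ | hle
    · rw [pairing_chain hj (by omega) ih] at hcn
      have := last_pos_of_mem_coeffs _ hc
      simp [chain] at hcn
      omega
    · have hle := pairing_le_of_mul_le hc hcn hle
      have hsum : pairing a (chain m) = pairing 0 (chain m) + ∑ l, a l * chain m l := by
        simp [pairing_eq_sum, add_mul, Finset.sum_add_distrib, add_comm]
      have h0 : pairing 0 (chain m) = m + 1 := pairing_chain (Nat.lt_succ_self m) (by omega)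
        fun _ _ => rfl
      have hi1 : a i * chain m i ≤ ∑ l, a l * chain m l :=
        Finset.single_le_sum (f := fun l => a l * chain m l) (fun _ _ => Nat.zero_le _)
          (Finset.mem_univ i)
      have hci : chain m i = 1 := by simp [chain]; omega
      rw [hci, mul_one] at hi1
      omega

lemma branch_eq_zero_of_covers {a : Fin 8 → ℕ} (h : Covers a)
    (h0 : ∀ i : Fin 8, 8 ≤ (i : ℕ) + 5 → a i = 0) : a 1 = 0 ∨ a 2 = 0 := by
  have hM := twentyEight_le_pairing_topCoeff a
  obtain ⟨c, hc, hcn⟩ := h 5 (by omega)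
  rcases chain_or_branch c hc with ⟨j, hj, rfl⟩ | hle | hle
  · rw [pairing_chain hj (by omega) h0] at hcn
    simp [chain] at hcn
    omega
  · have := pairing_le_of_mul_le hc hcn hle
    simp [pairing, chain] at this
    omega
  · have := pairing_le_of_mul_le hc hcn hle
    simp [pairing, chainTwo] at this
    omega

lemma covers_first_third_iff : ∀ x < 15, ∀ z < 8, 2 * x + 4 * z ≤ 29 →
    (Covers ![x, 0, z, 0, 0, 0, 0, 0] ↔ x ≤ 5 ∧ z ≤ 1) := by
  decide +kernel

lemma covers_first_second_iff : ∀ x < 15, ∀ y < 9, 2 * x + 3 * y ≤ 26 →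
    (Covers ![x, y + 1, 0, 0, 0, 0, 0, 0] ↔ (x ≤ 4 ∧ y = 0) ∨ (x = 0 ∧ y = 1)) := by
  decide +kernel

/-- the ACM criterion on E8/P_{α_8} (k = 8 is indexed here
    by 7). -/
theorem stmt16 (a : Fin 8 → ℕ) (h : a 7 = 0) :
    ACM8 a 7 ↔
      ((∃ i : ℕ, i ≤ 5 ∧ a = ![i, 0, 0, 0, 0, 0, 0, 0]) ∨
       (∃ i : ℕ, i ≤ 5 ∧ a = ![i, 0, 1, 0, 0, 0, 0, 0]) ∨
       (∃ j : ℕ, 1 ≤ j ∧ j ≤ 4 ∧ a = ![j, 1, 0, 0, 0, 0, 0, 0]) ∨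
       (∃ k : ℕ, 1 ≤ k ∧ k ≤ 2 ∧ a = ![0, k, 0, 0, 0, 0, 0, 0])) := by
  rw [ACM8_iff_covers]
  constructor
  · intro hcov
    have h0 := eq_zero_of_covers h hcov 5 le_rfl
    have hbranch := branch_eq_zero_of_covers hcov h0
    have hM := pairing_topCoeff_le_of_covers hcov
    obtain ⟨x, y, z, rfl⟩ : ∃ x y z, a = ![x, y, z, 0, 0, 0, 0, 0] := by
      refine ⟨a 0, a 1, a 2, funext fun i => ?_⟩
      fin_cases i <;> first | rfl | exact h0 _ (by decide)
    simp [pairing, topCoeff] at hM hbranch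
    rcases y with _ | y
    · obtain ⟨hx, hz⟩ := (covers_first_third_iff x (by omega) z (by omega) (by omega)).1 hcov
      interval_cases z
      · exact Or.inl ⟨x, hx, rfl⟩
      · exact Or.inr (Or.inl ⟨x, hx, rfl⟩)
    · obtain rfl : z = 0 := by omega
      rcases (covers_first_second_iff x (by omega) y (by omega) (by omega)).1 hcov
        with ⟨hx, rfl⟩ | ⟨rfl, rfl⟩
      · rcases Nat.eq_zero_or_pos x with rfl | hpos
        · exact Or.inr (Or.inr (Or.inr ⟨1, by omega, by omega, rfl⟩))
        · exact Or.inr (Or.inr (Or.inl ⟨x, hpos, hx, rfl⟩))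
      · exact Or.inr (Or.inr (Or.inr ⟨2, by omega, le_rfl, rfl⟩))
  · rintro (⟨x, hx, rfl⟩ | ⟨x, hx, rfl⟩ | ⟨x, hx, hx', rfl⟩ | ⟨y, hy, hy', rfl⟩)
    · exact (covers_first_third_iff x (by omega) 0 (by omega) (by omega)).2 (by omega)
    · exact (covers_first_third_iff x (by omega) 1 (by omega) (by omega)).2 (by omega)
    · exact (covers_first_second_iff x (by omega) 0 (by omega) (by omega)).2 (by omega)
    · obtain ⟨y, rfl⟩ : ∃ k, y = k + 1 := ⟨y - 1, by omega⟩
      exact (covers_first_second_iff 0 (by omega) y (by omega) (by omega)).2 (by omega)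
end
end
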